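/- arXiv:2202.03024 — 2 statements merged into one kernel-verified Lean document; each statement's English description precedes it below -/
import Mathlib

section
/- For every integer n ≥ 2, every integer q ≥ 2, and every word y ∈ Σ_q^{n−1} with run length profile (r_1, …, r_{ρ(y)}), the input entropy of the 1-deletion channel satisfies H^In_{1-Del}(y) = log₂(nq) − (1/(nq)) · Σ_{i=1}^{ρ(y)} (r_i + 1) log₂(r_i + 1); in particular, H^In_{1-Del}(y) is invariant under permutations of the run length profile of y. -/
open scoped Classical

noncomputable section

/-- The embedding number `ω_y(x)`: the number of distinct occurrences of `y`
as a subsequence of `x` (i.e. the number of index tuples realizing `y` in `x`). -/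
def emb {q : ℕ} (y x : List (Fin q)) : ℕ := x.sublists.count y

/-- The run length profile of a word: the list of lengths of its maximal
blocks of identical consecutive symbols, in order. -/
def runLengths {α : Type*} [DecidableEq α] : List α → List ℕ
  | [] => []
  | [_] => [1]
  | a :: b :: l =>
    if a = b then
      match runLengths (b :: l) with
      | [] => [1]
      | r :: rs => (r + 1) :: rs
    else 1 :: runLengths (b :: l)

/-- Input entropy `H^In_{k-Del}(y)` of the `k`-deletion channel over `Σ_q`
under uniform transmission, for a channel output `y ∈ Σ_q^{n-k}`:
`-∑_{x ∈ I_k(y)} p(x) log₂ p(x)` with `p(x) = ω_y(x) / (C(n,k) q^k)`. -/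
def Hdel (q n k : ℕ) (y : Fin (n - k) → Fin q) : ℝ :=
  - ∑ x ∈ Finset.univ.filter
      (fun x : Fin n → Fin q => (List.ofFn y).Sublist (List.ofFn x)),
      ((emb (List.ofFn y) (List.ofFn x) : ℝ) / ((n.choose k : ℝ) * (q : ℝ) ^ k)) *
        Real.logb 2 ((emb (List.ofFn y) (List.ofFn x) : ℝ) / ((n.choose k : ℝ) * (q : ℝ) ^ k))

/-- Input entropy `H^In_{k-Ins}(y)` of the `k`-insertion channel over `Σ_q`
under uniform transmission, for a channel output `y ∈ Σ_q^{n+k}`: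
`-∑_{x ∈ D_k(y)} p(x) log₂ p(x)` with `p(x) = ω_x(y) / C(n+k,k)`. -/
def Hins (q n k : ℕ) (y : Fin (n + k) → Fin q) : ℝ :=
  - ∑ x ∈ Finset.univ.filter
      (fun x : Fin n → Fin q => (List.ofFn x).Sublist (List.ofFn y)),
      ((emb (List.ofFn x) (List.ofFn y) : ℝ) / ((n + k).choose k : ℝ)) *
        Real.logb 2 ((emb (List.ofFn x) (List.ofFn y) : ℝ) / ((n + k).choose k : ℝ))

/-- A run length profile `rl` of a word of length `m` with `R` runs is balanced if it
consists of `m mod R` runs of length `⌈m/R⌉` and `R - (m mod R)` runs of length `⌊m/R⌋`. -/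
def isBalanced (m R : ℕ) (rl : List ℕ) : Prop :=
  rl.Perm (List.replicate (m % R) ((m + R - 1) / R) ++ List.replicate (R - m % R) (m / R))

/-- A run length profile `rl` of a word of length `m` with `R` runs is skewed if it
consists of `R - 1` runs of length `1` and a single run of length `m - (R-1)`. -/
def isSkewed (m R : ℕ) (rl : List ℕ) : Prop :=
  rl.Perm ((m - (R - 1)) :: List.replicate (R - 1) 1)

/-- `fIdx rl i` is the smallest (1-based) index `j ∈ [i+1, R]` with `r_j > 1`;
it is `R` if no such index exists, and `fIdx rl R = R`. -/
def fIdx (rl : List ℕ) (i : ℕ) : ℕ :=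
  if i = rl.length then rl.length
  else if {j | i + 1 ≤ j ∧ j ≤ rl.length ∧ 1 < rl.getD (j - 1) 0}.Nonempty
    then sInf {j | i + 1 ≤ j ∧ j ≤ rl.length ∧ 1 < rl.getD (j - 1) 0}
    else rl.length

/-- `bIdx rl i` is the largest (1-based) index `j ∈ [1, i]` with `r_j > 1`;
it is `1` if no such index exists, and `bIdx rl 0 = 1`. -/
def bIdx (rl : List ℕ) (i : ℕ) : ℕ :=
  if i = 0 then 1
  else if {j | 1 ≤ j ∧ j ≤ i ∧ 1 < rl.getD (j - 1) 0}.Nonempty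
    then sSup {j | 1 ≤ j ∧ j ≤ i ∧ 1 < rl.getD (j - 1) 0}
    else 1

theorem emb_nil {q : ℕ} (x : List (Fin q)) : emb [] x = 1 := by
  unfold emb
  rw [(List.sublists_perm_sublists' x).count_eq]
  induction x with
  | nil => simp
  | cons b x ih =>
    rw [List.sublists'_cons, List.count_append, ih, List.count_eq_zero.2]
    simp

theorem emb_cons_cons {q : ℕ} (a b : Fin q) (y x : List (Fin q)) :
    emb (a :: y) (b :: x) = emb (a :: y) x + if b = a then emb y x else 0 := by
  unfold emb
  rw [(List.sublists_perm_sublists' (b :: x)).count_eq, (List.sublists_perm_sublists' x).count_eq,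
    (List.sublists_perm_sublists' x).count_eq, List.sublists'_cons, List.count_append]
  congr 1
  split_ifs with h
  · subst h
    exact List.count_map_of_injective _ _ List.cons_injective _
  · rw [List.count_eq_zero]
    simp [h]

theorem emb_eq_zero {q : ℕ} {y x : List (Fin q)} (h : ¬ y.Sublist x) : emb y x = 0 := by
  unfold emb
  rw [List.count_eq_zero, List.mem_sublists]
  exact h

theorem emb_self {q : ℕ} (x : List (Fin q)) : emb x x = 1 := by
  induction x with
  | nil => exact emb_nil _
  | cons a x ih =>
    rw [emb_cons_cons, ih, emb_eq_zero fun h => by simpa using h.length_le]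
    simp

theorem emb_of_length_eq {q : ℕ} {y x : List (Fin q)} (h : y.length = x.length) :
    emb y x = if x = y then 1 else 0 := by
  split_ifs with hxy
  · rw [hxy, emb_self]
  · exact emb_eq_zero fun hs => hxy (hs.eq_of_length h).symm

theorem emb_cons_cons_self {q : ℕ} (a : Fin q) (y : List (Fin q)) :
    emb (a :: y) (a :: a :: y) = emb y (a :: y) + 1 := by
  rw [emb_cons_cons, emb_self, if_pos rfl, add_comm]

theorem emb_cons_cons_of_ne {q : ℕ} {a b : Fin q} (h : a ≠ b) (y : List (Fin q)) :
    emb (b :: y) (a :: b :: y) = 1 := by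
  rw [emb_cons_cons, emb_self, if_neg h]

/-- The first run of `a :: y` has length `emb y (a :: y)`. -/
theorem exists_runLengths_cons {q : ℕ} (a : Fin q) (y : List (Fin q)) :
    ∃ rs, runLengths (a :: y) = emb y (a :: y) :: rs := by
  induction y generalizing a with
  | nil => exact ⟨[], by simp [runLengths, emb_nil]⟩
  | cons b y ih =>
    by_cases h : a = b
    · subst h
      obtain ⟨rs, hrs⟩ := ih a
      exact ⟨rs, by simp [runLengths, hrs, emb_cons_cons_self]⟩
    · exact ⟨_, by rw [runLengths, if_neg h, emb_cons_cons_of_ne h]⟩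

/-- Prepending a letter either creates a new run of length one or lengthens the first run. -/
theorem sum_map_runLengths_cons {q : ℕ} (a : Fin q) (y : List (Fin q)) :
    ∃ k, emb y (a :: y) = k + 1 ∧ ∀ f : ℕ → ℝ,
      ((runLengths (a :: y)).map f).sum + (if k = 0 then 0 else f k) =
        ((runLengths y).map f).sum + f (k + 1) := by
  cases y with
  | nil => exact ⟨0, by simp [runLengths, emb_nil]⟩
  | cons b y =>
    by_cases h : a = b
    · subst h
      obtain ⟨rs, hrs⟩ := exists_runLengths_cons a y
      have hpos : emb y (a :: y) ≠ 0 := by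
        unfold emb
        rw [Ne, List.count_eq_zero, List.mem_sublists, not_not]
        exact List.sublist_cons_self a y
      refine ⟨emb y (a :: y), emb_cons_cons_self a y, fun f => ?_⟩
      simp only [runLengths, if_true, hrs, if_neg hpos, List.map_cons, List.sum_cons]
      ring
    · refine ⟨0, emb_cons_cons_of_ne h y, fun f => ?_⟩
      rw [runLengths, if_neg h]
      simp [add_comm]

theorem sum_ofFn_succ {q m : ℕ} (F : List (Fin q) → ℝ) :
    ∑ x : Fin (m + 1) → Fin q, F (List.ofFn x) =
      ∑ b : Fin q, ∑ x : Fin m → Fin q, F (b :: List.ofFn x) := by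
  rw [← (Fin.consEquiv fun _ : Fin (m + 1) => Fin q).sum_comp, Fintype.sum_prod_type]
  simp [Fin.consEquiv, List.ofFn_succ]

theorem sum_ofFn_eq_of_forall_ne {q m : ℕ} (F G : List (Fin q) → ℝ)
    {z : List (Fin q)} (hz : z.length = m) (h : ∀ x, x.length = m → x ≠ z → F x = G x) :
    ∑ x : Fin m → Fin q, F (List.ofFn x) =
      ∑ x : Fin m → Fin q, G (List.ofFn x) - G z + F z := by
  subst hz
  have hsum : ∑ x : Fin z.length → Fin q, (F (List.ofFn x) - G (List.ofFn x)) = F z - G z := by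
    rw [Finset.sum_eq_single z.get]
    · rw [List.ofFn_get]
    · intro x _ hx
      rw [h _ (List.length_ofFn), sub_self]
      intro hxz
      exact hx (List.ofFn_injective (hxz.trans (List.ofFn_get z).symm))
    · simp
  rw [Finset.sum_sub_distrib] at hsum
  linarith

theorem sum_emb {q : ℕ} (f : ℕ → ℝ) (hf : f 0 = 0) (y : List (Fin q)) :
    ∑ x : Fin (y.length + 1) → Fin q, f (emb y (List.ofFn x)) =
      ((runLengths y).map fun r => f (r + 1)).sum +
        (((y.length : ℝ) + 1) * q - ((runLengths y).map fun r : ℕ => (r : ℝ) + 1).sum) * f 1 := by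
  induction y with
  | nil => simp [emb_nil, runLengths]
  | cons a y ih =>
    have hb : ∀ b : Fin q, ∑ x : Fin (y.length + 1) → Fin q, f (emb (a :: y) (b :: List.ofFn x)) =
        f 1 + if b = a then (∑ x : Fin (y.length + 1) → Fin q, f (emb y (List.ofFn x)))
          - f (emb y (a :: y)) + f (emb y (a :: y) + 1) - f 1 else 0 := by
      intro b
      split_ifs with h
      · subst h
        rw [sum_ofFn_eq_of_forall_ne (fun x => f (emb (b :: y) (b :: x))) (fun x => f (emb y x))
          (m := y.length + 1) (z := b :: y) rfl]
        · rw [emb_cons_cons_self]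
          ring
        · intro x hl hx
          simp [emb_cons_cons, emb_of_length_eq (y := b :: y) (x := x) (by simp [hl]), hx]
      · rw [sum_ofFn_eq_of_forall_ne (fun x => f (emb (a :: y) (b :: x))) (fun _ => 0)
          (m := y.length + 1) (z := a :: y) rfl]
        · simp [emb_cons_cons, emb_self, h]
        · intro x hl hx
          simp [emb_cons_cons, emb_of_length_eq (y := a :: y) (x := x) (by simp [hl]), hx, h, hf]
    rw [List.length_cons, sum_ofFn_succ (fun x => f (emb (a :: y) x)),
      Finset.sum_congr rfl fun b _ => hb b, Finset.sum_add_distrib,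
      Finset.sum_ite_eq' Finset.univ a, ih]
    obtain ⟨k, hk, hsum⟩ := sum_map_runLengths_cons a y
    have h1 := hsum fun r => f (r + 1)
    have h2 := hsum fun r : ℕ => (r : ℝ) + 1
    simp only [Finset.sum_const, Finset.card_univ, Fintype.card_fin, nsmul_eq_mul,
      Finset.mem_univ, if_true, hk]
    by_cases hk0 : k = 0
    · subst hk0
      simp only [if_true, add_zero] at h1 h2
      rw [h1, h2]
      push_cast
      ring
    · rw [if_neg hk0] at h1 h2
      rw [eq_sub_of_add_eq h1, eq_sub_of_add_eq h2]
      push_cast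
      ring

theorem Hdel_one_eq {q m : ℕ} (hq : q ≠ 0) (y : List (Fin q)) (hy : y.length = m) :
    - ∑ x ∈ Finset.univ.filter (fun x : Fin (m + 1) → Fin q => y.Sublist (List.ofFn x)),
      ((emb y (List.ofFn x) : ℝ) / (((m + 1).choose 1 : ℝ) * (q : ℝ) ^ 1)) *
        Real.logb 2 ((emb y (List.ofFn x) : ℝ) / (((m + 1).choose 1 : ℝ) * (q : ℝ) ^ 1)) =
      Real.logb 2 (((m + 1 : ℕ) : ℝ) * q) - (1 / (((m + 1 : ℕ) : ℝ) * q)) *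
        ((runLengths y).map (fun r : ℕ => ((r : ℝ) + 1) * Real.logb 2 ((r : ℝ) + 1))).sum := by
  subst hy
  rw [Nat.choose_one_right, pow_one]
  have hcast : ((y.length : ℝ) + 1) * q = ((y.length + 1 : ℕ) : ℝ) * q := by push_cast; rfl
  have hN0 : ((y.length + 1 : ℕ) : ℝ) * q ≠ 0 := by positivity
  have hsum := sum_emb (fun t => (t : ℝ) / (((y.length + 1 : ℕ) : ℝ) * q) *
    Real.logb 2 ((t : ℝ) / (((y.length + 1 : ℕ) : ℝ) * q))) (by simp) y
  rw [hcast] at hsum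
  generalize ((y.length + 1 : ℕ) : ℝ) * q = N at hN0 hsum ⊢
  rw [Finset.sum_filter_of_ne, hsum]
  · have hmap : ((runLengths y).map fun r : ℕ => ((r + 1 : ℕ) : ℝ) / N *
        Real.logb 2 (((r + 1 : ℕ) : ℝ) / N)).sum =
        1 / N * ((runLengths y).map fun r : ℕ => ((r : ℝ) + 1) * Real.logb 2 ((r : ℝ) + 1)).sum -
          Real.logb 2 N / N * ((runLengths y).map fun r : ℕ => (r : ℝ) + 1).sum := by
      induction runLengths y with
      | nil => simp
      | cons r rs ih =>
        simp only [List.map_cons, List.sum_cons, ih]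
        rw [Real.logb_div (by positivity) hN0]
        push_cast
        ring
    rw [hmap, Nat.cast_one, Real.logb_div one_ne_zero hN0, Real.logb_one]
    field_simp
    ring
  · intro x _ hx
    by_contra h
    exact hx (by rw [emb_eq_zero h]; simp)

/-- For `n ≥ 2`, `q ≥ 2` and `y ∈ Σ_q^{n-1}` with run length profile `(r_1, …, r_ρ(y))`,
`H^In_{1-Del}(y) = log₂(nq) - (1/(nq)) ∑_i (r_i + 1) log₂ (r_i + 1)`; in particular the
input entropy is invariant under permutations of the run length profile. -/
theorem stmt_3 (q n : ℕ) (hq : 2 ≤ q) (hn : 2 ≤ n) (y : Fin (n - 1) → Fin q) :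
    (Hdel q n 1 y =
      Real.logb 2 ((n : ℝ) * q) -
        (1 / ((n : ℝ) * q)) *
          ((runLengths (List.ofFn y)).map
            (fun r => ((r : ℝ) + 1) * Real.logb 2 ((r : ℝ) + 1))).sum)
    ∧ ∀ y' : Fin (n - 1) → Fin q,
        (runLengths (List.ofFn y')).Perm (runLengths (List.ofFn y)) →
          Hdel q n 1 y' = Hdel q n 1 y := by
  obtain ⟨m, rfl⟩ : ∃ m, n = m + 1 := ⟨n - 1, by omega⟩
  have hcoe (f : ℝ → ℝ) (l : List ℕ) :
      List.map f (do let a ← l; pure (a : ℝ)) = l.map fun r : ℕ => f r := by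
    induction l <;> simp_all
  have key (z : Fin (m + 1 - 1) → Fin q) :=
    Hdel_one_eq (m := m) (by omega : q ≠ 0) (List.ofFn z) List.length_ofFn
  rw [hcoe]
  refine ⟨key y, fun y' h => ?_⟩
  unfold Hdel
  rw [key y, key y', (h.map _).sum_eq]

end
end

section
/- For every integer n ≥ 1, every integer q ≥ 2, and every word y ∈ Σ_q^{n+1} with run length profile (r_1, …, r_{ρ(y)}), the input entropy of the 1-insertion channel satisfies H^In_{1-Ins}(y) = log₂(n+1) − (1/(n+1)) · Σ_{i=1}^{ρ(y)} r_i log₂(r_i). -/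
open scoped Classical

noncomputable section

/-- The words obtained from a word by deleting one symbol, listed once per deleted position. -/
def singleDeletions {α : Type*} : List α → List (List α)
  | [] => []
  | a :: l => l :: (singleDeletions l).map (List.cons a)

theorem length_singleDeletions {α : Type*} (l : List α) :
    (singleDeletions l).length = l.length := by
  induction l with
  | nil => rfl
  | cons a l ih => simp [singleDeletions, ih]

theorem sublistsLen_length_cons {α : Type*} (a : α) (l : List α) :
    List.sublistsLen l.length (a :: l) = singleDeletions (a :: l) := by
  induction l generalizing a with
  | nil => simp [singleDeletions]
  | cons b l ih =>
    rw [List.length_cons, List.sublistsLen_succ_cons, ih, ← List.length_cons (a := b),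
      List.sublistsLen_length]
    rfl

theorem count_sublists' {α : Type*} [DecidableEq α] (x l : List α) :
    l.sublists'.count x = (List.sublistsLen x.length l).count x := by
  induction l generalizing x with
  | nil => cases x <;> simp
  | cons a l ih =>
    rw [List.sublists'_cons, List.count_append, ih]
    cases x with
    | nil =>
      rw [List.count_eq_zero.2 (by simp : [] ∉ l.sublists'.map (List.cons a))]
      simp
    | cons b x =>
      rw [List.length_cons, List.sublistsLen_succ_cons, List.count_append]
      congr 1
      by_cases h : a = b
      · subst h
        rw [List.count_map_of_injective _ _ List.cons_injective,
          List.count_map_of_injective _ _ List.cons_injective, ih]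
      · rw [List.count_eq_zero.2, List.count_eq_zero.2] <;> simp [h]

theorem emb_eq_count_singleDeletions {q : ℕ} {x y : List (Fin q)}
    (h : y.length = x.length + 1) : emb x y = (singleDeletions y).count x := by
  obtain _ | ⟨a, l⟩ := y
  · simp at h
  · rw [emb, (List.sublists_perm_sublists' _).count_eq, count_sublists',
      ← sublistsLen_length_cons, Nat.succ_injective h]

theorem runLengths_cons_self {α : Type*} [DecidableEq α] (a : α) (l : List α) :
    ∃ rs, runLengths (a :: l) = (singleDeletions (a :: l)).count l :: rs := by
  induction l generalizing a with
  | nil => exact ⟨[], by simp [runLengths, singleDeletions]⟩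
  | cons b l ih =>
    obtain ⟨rs, hrs⟩ := ih b
    by_cases h : a = b
    · subst h
      refine ⟨rs, ?_⟩
      rw [runLengths, if_pos rfl, hrs, singleDeletions.eq_2 a (a :: l), List.count_cons_self,
        List.count_map_of_injective _ _ List.cons_injective]
    · refine ⟨runLengths (b :: l), ?_⟩
      rw [runLengths, if_neg h, singleDeletions, List.count_cons_self, List.count_eq_zero.2]
      simp [h]

/-- The multiplicities of the single deletions of a word are its run lengths. -/
theorem sum_count_singleDeletions {α M : Type*} [DecidableEq α] [AddCancelCommMonoid M]
    (g : ℕ → M) (l : List α) :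
    ∑ x ∈ (singleDeletions l).toFinset, g ((singleDeletions l).count x) =
      ((runLengths l).map g).sum := by
  induction l with
  | nil => simp [singleDeletions, runLengths]
  | cons a l ih =>
    have hmap : ((singleDeletions l).map (List.cons a)).toFinset =
        (singleDeletions l).toFinset.map ⟨List.cons a, List.cons_injective⟩ := by
      ext; simp
    obtain _ | ⟨b, l⟩ := l
    · simp [singleDeletions, runLengths]
    by_cases h : a = b
    · subst h
      obtain ⟨rs, hrs⟩ := runLengths_cons_self a l
      have hmem : l ∈ (singleDeletions (a :: l)).toFinset := by simp [singleDeletions]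
      have hrest : ∑ x ∈ (singleDeletions (a :: l)).toFinset.erase l,
          g ((singleDeletions (a :: a :: l)).count (a :: x)) =
          ∑ x ∈ (singleDeletions (a :: l)).toFinset.erase l,
            g ((singleDeletions (a :: l)).count x) := by
        refine Finset.sum_congr rfl fun x hx => ?_
        rw [singleDeletions, List.count_cons_of_ne,
          List.count_map_of_injective _ _ List.cons_injective]
        simpa using (Finset.ne_of_mem_erase hx).symm
      rw [← Finset.add_sum_erase _ _ hmem, hrs, List.map_cons, List.sum_cons] at ih
      have hrun : runLengths (a :: a :: l) =
          ((singleDeletions (a :: l)).count l + 1) :: rs := by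
        rw [runLengths, if_pos rfl, hrs]
      have hset : (singleDeletions (a :: a :: l)).toFinset =
          (singleDeletions (a :: l)).toFinset.map ⟨List.cons a, List.cons_injective⟩ := by
        rw [singleDeletions, List.toFinset_cons, hmap, Finset.insert_eq_self]
        simpa using hmem
      have hcount : (singleDeletions (a :: a :: l)).count (a :: l) =
          (singleDeletions (a :: l)).count l + 1 := by
        rw [singleDeletions, List.count_cons_self,
          List.count_map_of_injective _ _ List.cons_injective]
      rw [hset, Finset.sum_map, ← Finset.add_sum_erase _ _ hmem, hrun, List.map_cons,
        List.sum_cons]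
      simp only [Function.Embedding.coeFn_mk]
      rw [hrest, hcount, add_left_cancel ih]
    · have hmem : b :: l ∉ (singleDeletions (b :: l)).map (List.cons a) := by simp [h]
      rw [runLengths, if_neg h, List.map_cons, List.sum_cons, ← ih, singleDeletions,
        List.toFinset_cons, Finset.sum_insert (by simpa using hmem), List.count_cons_self,
        List.count_eq_zero.2 hmem, hmap, Finset.sum_map]
      congr 1
      refine Finset.sum_congr rfl fun x hx => ?_
      rw [Function.Embedding.coeFn_mk, List.count_cons_of_ne (by simp [Ne.symm h]),
        List.count_map_of_injective _ _ List.cons_injective]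

theorem sum_runLengths {α : Type*} [DecidableEq α] (l : List α) :
    (runLengths l).sum = l.length := by
  have h := sum_count_singleDeletions id l
  rw [List.map_id] at h
  rw [← length_singleDeletions, ← List.sum_toFinset_count_eq_length]
  convert h.symm using 3
  simp only [id]
  congr 1
  exact lawful_beq_subsingleton _ _

theorem mem_singleDeletions_iff_sublist {α : Type*} {x y : List α}
    (h : y.length = x.length + 1) :
    x ∈ singleDeletions y ↔ x.Sublist y := by
  obtain _ | ⟨a, l⟩ := y
  · simp at h
  · have h := Nat.succ_injective h
    rw [← sublistsLen_length_cons, List.mem_sublistsLen]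
    simp [h]

theorem sum_filter_sublist_eq_sum_runLengths {q n : ℕ} (y : Fin (n + 1) → Fin q) (g : ℕ → ℝ) :
    ∑ x ∈ Finset.univ.filter
        (fun x : Fin n → Fin q => (List.ofFn x).Sublist (List.ofFn y)),
      g (emb (List.ofFn x) (List.ofFn y)) = ((runLengths (List.ofFn y)).map g).sum := by
  rw [← sum_count_singleDeletions]
  refine Finset.sum_bij (fun x _ => List.ofFn x) ?_ ?_ ?_ ?_
  · intro x hx
    rw [List.mem_toFinset, mem_singleDeletions_iff_sublist (by simp)]
    simpa using hx
  · exact fun x _ z _ h => List.ofFn_injective h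
  · intro x hx
    obtain rfl : x.length = n := by
      rw [List.mem_toFinset, List.ofFn_succ, ← sublistsLen_length_cons] at hx
      simpa using (List.mem_sublistsLen.1 hx).2
    refine ⟨x.get, ?_, List.ofFn_get x⟩
    rw [List.mem_toFinset, mem_singleDeletions_iff_sublist (by simp)] at hx
    simpa using hx
  · intro x _
    rw [emb_eq_count_singleDeletions (by simp)]

/-- For `n ≥ 1`, `q ≥ 2` and `y ∈ Σ_q^{n+1}` with run length profile `(r_1, …, r_ρ(y))`,
`H^In_{1-Ins}(y) = log₂(n+1) - (1/(n+1)) ∑_i r_i log₂ r_i`. -/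
theorem stmt_5 (q n : ℕ) (hq : 2 ≤ q) (hn : 1 ≤ n) (y : Fin (n + 1) → Fin q) :
    Hins q n 1 y =
      Real.logb 2 ((n : ℝ) + 1) -
        (1 / ((n : ℝ) + 1)) *
          ((runLengths (List.ofFn y)).map
            (fun r => (r : ℝ) * Real.logb 2 (r : ℝ))).sum := by
  have hN : (n : ℝ) + 1 ≠ 0 := by positivity
  have key : ∀ L : List ℕ, (L.map fun r : ℕ => ((r : ℝ) / ((n : ℝ) + 1)) *
      Real.logb 2 ((r : ℝ) / ((n : ℝ) + 1))).sum =
      (1 / ((n : ℝ) + 1)) * (L.map fun r : ℕ => (r : ℝ) * Real.logb 2 (r : ℝ)).sum -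
        (L.sum : ℝ) / ((n : ℝ) + 1) * Real.logb 2 ((n : ℝ) + 1) := by
    intro L
    induction L with
    | nil => simp
    | cons r L ih =>
      rw [List.map_cons, List.sum_cons, ih, List.map_cons, List.sum_cons, List.sum_cons,
        Nat.cast_add]
      rcases eq_or_ne r 0 with rfl | hr
      · simp
      · rw [Real.logb_div (Nat.cast_ne_zero.2 hr) hN]
        ring
  simp only [Hins, Nat.choose_one_right, Nat.cast_add, Nat.cast_one]
  rw [sum_filter_sublist_eq_sum_runLengths y
    (fun r => ((r : ℝ) / ((n : ℝ) + 1)) * Real.logb 2 ((r : ℝ) / ((n : ℝ) + 1))),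
    key, sum_runLengths, List.length_ofFn, Nat.cast_add, Nat.cast_one, div_self hN]
  simp only [bind_pure_comp, List.map_eq_map, List.map_map, Function.comp_def]
  ring

end
end
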